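/- With notation as in the path-contraction setup, the kernel of the restriction map ρ: Spl_R(G,α) → Spl_R(G',α') is isomorphic as an R-module to Spl_R(P_k, α|_{P_k}; {v₀,v_k}), the module of splines on the path P_k vanishing at both endpoints; and this module is in turn isomorphic to Spl_R(C_k, α|_{P_k}; u), the based splines on the k-cycle C_k obtained by identifying v₀ with v_k. -/

import Mathlib

/-- An edge-labeled graph: a finite (multi)graph together with an assignment
of an ideal of `R` to each edge. -/
structure ELGraph (R : Type) [CommRing R] where
  V : Type
  E : Type
  [fV : Fintype V]
  [fE : Fintype E]
  [dV : DecidableEq V]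
  ends : E → V × V
  lab : E → Ideal R

attribute [instance] ELGraph.fV ELGraph.fE ELGraph.dV

variable {R : Type} [CommRing R]

/-- `p` is a generalized spline on `(G, α)`. -/
def ELGraph.IsSpline (G : ELGraph R) (p : G.V → R) : Prop :=
  ∀ e : G.E, p (G.ends e).1 - p (G.ends e).2 ∈ G.lab e

/-- The module of generalized splines on `(G, α)`, as a submodule of `⊕_{v} R`. -/
def splSub (G : ELGraph R) : Submodule R (G.V → R) where
  carrier := {p | G.IsSpline p}
  add_mem' := by
    intro p q hp hq e
    simpa [ELGraph.IsSpline, add_sub_add_comm] using Ideal.add_mem _ (hp e) (hq e)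
  zero_mem' := by intro e; simp
  smul_mem' := by
    intro c p hp e
    simpa [ELGraph.IsSpline, mul_sub] using Submodule.smul_mem _ c (hp e)

/-- The degree of a vertex (loops count twice). -/
noncomputable def ELGraph.degree (G : ELGraph R) (w : G.V) : ℕ :=
  (Finset.univ.filter fun e : G.E => (G.ends e).1 = w).card +
  (Finset.univ.filter fun e : G.E => (G.ends e).2 = w).card

section PathContraction

variable (G : ELGraph R) (k : ℕ) (v : Fin (k + 1) → G.V) (e : Fin k → G.E)

/-- The interior vertices `v₁, …, v_{k−1}` of the path. -/
def pathInterior : Set G.V :=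
  {w | ∃ j : Fin (k + 1), (j : ℕ) ≠ 0 ∧ (j : ℕ) ≠ k ∧ w = v j}


/-- The kernel of the restriction map `ρ : Spl_R(G,α) → Spl_R(G',α')`: the splines
on `G` vanishing at every vertex outside the interior of the path. -/
def pathKernel : Submodule R (G.V → R) :=
  splSub G ⊓ ⨅ w : {w : G.V // w ∉ pathInterior G k v},
    LinearMap.ker (LinearMap.proj w.1 : (G.V → R) →ₗ[R] R)

/-- Splines on the path `P_k = v₀v₁⋯v_k` (with the labels inherited from `G`)
vanishing at both endpoints `v₀` and `v_k`. -/
def basedPathSpl : Submodule R (Fin (k + 1) → R) :=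
  (⨅ i : Fin k, Submodule.comap
      ((LinearMap.proj i.castSucc : (Fin (k + 1) → R) →ₗ[R] R) -
        (LinearMap.proj i.succ : (Fin (k + 1) → R) →ₗ[R] R))
      (G.lab (e i))) ⊓
    LinearMap.ker (LinearMap.proj (0 : Fin (k + 1)) : (Fin (k + 1) → R) →ₗ[R] R) ⊓
    LinearMap.ker (LinearMap.proj (Fin.last k) : (Fin (k + 1) → R) →ₗ[R] R)

/-- Based splines on the `k`-cycle `C_k` obtained from `P_k` by identifying the two
endpoints to a single vertex `u = 0`: the `i`-th edge of the cycle joins `i` and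
`i+1 (mod k)` and carries the label of the `i`-th path edge, and the splines are
required to vanish at `u`. -/
def basedCycleSpl (hk : 0 < k) : Submodule R (Fin k → R) :=
  haveI : NeZero k := ⟨hk.ne'⟩
  (⨅ i : Fin k, Submodule.comap
      ((LinearMap.proj i : (Fin k → R) →ₗ[R] R) -
        (LinearMap.proj (i + 1) : (Fin k → R) →ₗ[R] R))
      (G.lab (e i))) ⊓
    LinearMap.ker (LinearMap.proj (0 : Fin k) : (Fin k → R) →ₗ[R] R)

variable {G k v e}

theorem mem_pathKernel {p : G.V → R} :
    p ∈ pathKernel G k v ↔ G.IsSpline p ∧ ∀ w, w ∉ pathInterior G k v → p w = 0 := by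
  simp only [pathKernel, Submodule.mem_inf, Submodule.mem_iInf, LinearMap.mem_ker,
    LinearMap.proj_apply, Subtype.forall]
  rfl

theorem mem_basedPathSpl {r : Fin (k + 1) → R} :
    r ∈ basedPathSpl G k e ↔
      (∀ i : Fin k, r i.castSucc - r i.succ ∈ G.lab (e i)) ∧ r 0 = 0 ∧ r (Fin.last k) = 0 := by
  simp [basedPathSpl, and_assoc]

theorem mem_basedCycleSpl {n : ℕ} {e : Fin (n + 1) → G.E} {hk : 0 < n + 1}
    {s : Fin (n + 1) → R} :
    s ∈ basedCycleSpl G (n + 1) e hk ↔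
      (∀ i : Fin (n + 1), s i - s (i + 1) ∈ G.lab (e i)) ∧ s 0 = 0 := by
  simp only [basedCycleSpl, Submodule.mem_inf, Submodule.mem_iInf, Submodule.mem_comap,
    LinearMap.mem_ker, LinearMap.sub_apply, LinearMap.proj_apply]

theorem ELGraph.degree_eq_sum (w : G.V) :
    G.degree w = ∑ f : G.E,
      ((if (G.ends f).1 = w then 1 else 0) + if (G.ends f).2 = w then 1 else 0) := by
  simp only [ELGraph.degree, Finset.sum_add_distrib, Finset.card_filter]

/-- The number of edges incident to a vertex is at most its degree. -/
theorem ELGraph.card_le_degree {w : G.V} {s : Finset G.E}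
    (hs : ∀ f ∈ s, (G.ends f).1 = w ∨ (G.ends f).2 = w) : s.card ≤ G.degree w := by
  rw [G.degree_eq_sum, Finset.card_eq_sum_ones]
  refine (Finset.sum_le_sum fun f hf => ?_).trans
    (Finset.sum_le_sum_of_subset (Finset.subset_univ s))
  rcases hs f hf with h | h <;> simp [h]

/-- Every edge meeting an interior vertex of the path is a path edge. -/
theorem mem_range_of_incident (he : Function.Injective e)
    (hpath : ∀ i : Fin k,
      G.ends (e i) = (v i.castSucc, v i.succ) ∨ G.ends (e i) = (v i.succ, v i.castSucc))
    {j : Fin (k + 1)} (hj0 : (j : ℕ) ≠ 0) (hjk : (j : ℕ) ≠ k) (hdeg : G.degree (v j) = 2)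
    {f : G.E} (hf : (G.ends f).1 = v j ∨ (G.ends f).2 = v j) : f ∈ Set.range e := by
  classical
  by_contra hfe
  let a : Fin k := ⟨j - 1, by omega⟩
  let b : Fin k := ⟨j, by omega⟩
  have ha : a.succ = j := by ext; simp [a]; omega
  have hb : b.castSucc = j := rfl
  have hab : e a ≠ e b := fun h => by
    have := congrArg Fin.val (he h)
    simp only [a, b] at this
    omega
  have hfa : f ≠ e a := fun h => hfe ⟨a, h.symm⟩
  have hfb : f ≠ e b := fun h => hfe ⟨b, h.symm⟩
  have hcard : ({f, e a, e b} : Finset G.E).card = 3 := Finset.card_eq_three.2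
    ⟨f, e a, e b, hfa, hfb, hab, rfl⟩
  have hle : ({f, e a, e b} : Finset G.E).card ≤ G.degree (v j) := by
    refine ELGraph.card_le_degree fun g hg => ?_
    simp only [Finset.mem_insert, Finset.mem_singleton] at hg
    rcases hg with rfl | rfl | rfl
    · exact hf
    · rcases hpath a with h | h <;> simp [h, ha]
    · rcases hpath b with h | h <;> simp [h, hb]
  omega

theorem ELGraph.IsSpline.sub_mem_of_path {p : G.V → R} (hp : G.IsSpline p) {i : Fin k}
    (hi : G.ends (e i) = (v i.castSucc, v i.succ) ∨ G.ends (e i) = (v i.succ, v i.castSucc)) :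
    p (v i.castSucc) - p (v i.succ) ∈ G.lab (e i) := by
  have h := hp (e i)
  rcases hi with hi | hi <;> rw [hi] at h
  · exact h
  · rw [← neg_sub]
    exact neg_mem h

theorem comp_mem_basedPathSpl (hv : Function.Injective v)
    (hpath : ∀ i : Fin k,
      G.ends (e i) = (v i.castSucc, v i.succ) ∨ G.ends (e i) = (v i.succ, v i.castSucc))
    {p : G.V → R} (hp : p ∈ pathKernel G k v) : p ∘ v ∈ basedPathSpl G k e := by
  rw [mem_pathKernel] at hp
  refine mem_basedPathSpl.2 ⟨fun i => ELGraph.IsSpline.sub_mem_of_path hp.1 (hpath i),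
    hp.2 _ ?_, hp.2 _ ?_⟩
  · rintro ⟨j, hj, -, h⟩
    exact hj (by rw [← hv h]; rfl)
  · rintro ⟨j, -, hj, h⟩
    exact hj (by rw [← hv h]; rfl)

/-- Extending a based path spline by zero gives a spline on the whole graph. -/
theorem extend_mem_pathKernel
    (hv : Function.Injective v) (he : Function.Injective e)
    (hpath : ∀ i : Fin k,
      G.ends (e i) = (v i.castSucc, v i.succ) ∨ G.ends (e i) = (v i.succ, v i.castSucc))
    (hdeg : ∀ j : Fin (k + 1), (j : ℕ) ≠ 0 → (j : ℕ) ≠ k → G.degree (v j) = 2)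
    {r : Fin (k + 1) → R} (hr : r ∈ basedPathSpl G k e) :
    Function.extend v r 0 ∈ pathKernel G k v := by
  obtain ⟨hr, h0, hlast⟩ := mem_basedPathSpl.1 hr
  have hzero : ∀ w, w ∉ pathInterior G k v → Function.extend v r 0 w = 0 := by
    intro w hw
    by_cases hwv : ∃ j, v j = w
    · obtain ⟨j, rfl⟩ := hwv
      rw [hv.extend_apply]
      by_cases hj0 : (j : ℕ) = 0
      · rwa [show j = 0 from Fin.ext hj0]
      by_cases hjk : (j : ℕ) = k
      · rwa [show j = Fin.last k from Fin.ext hjk]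
      exact absurd ⟨j, hj0, hjk, rfl⟩ hw
    · rw [Function.extend_apply' _ _ _ hwv]
      rfl
  refine mem_pathKernel.2 ⟨fun f => ?_, hzero⟩
  by_cases hf : f ∈ Set.range e
  · obtain ⟨i, rfl⟩ := hf
    rcases hpath i with h | h <;> rw [h] <;> simp only [hv.extend_apply]
    · exact hr i
    · rw [← neg_sub]
      exact neg_mem (hr i)
  · have hnot : ∀ w, ((G.ends f).1 = w ∨ (G.ends f).2 = w) → w ∉ pathInterior G k v := by
      rintro _ hw ⟨j, hj0, hjk, rfl⟩
      exact hf (mem_range_of_incident he hpath hj0 hjk (hdeg j hj0 hjk) hw)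
    rw [hzero _ (hnot _ (Or.inl rfl)), hzero _ (hnot _ (Or.inr rfl)), sub_zero]
    exact zero_mem _

theorem comp_castSucc_mem_basedCycleSpl (hk : 0 < k) {r : Fin (k + 1) → R}
    (hr : r ∈ basedPathSpl G k e) : r ∘ Fin.castSucc ∈ basedCycleSpl G k e hk := by
  obtain ⟨n, rfl⟩ := Nat.exists_eq_succ_of_ne_zero hk.ne'
  obtain ⟨hr, h0, hlast⟩ := mem_basedPathSpl.1 hr
  refine mem_basedCycleSpl.2 ⟨fun i => ?_, h0⟩
  have hi := hr i
  induction i using Fin.lastCases with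
  | last =>
    rw [Fin.succ_last, hlast] at hi
    simpa [h0] using hi
  | cast i => simpa [Fin.coeSucc_eq_succ] using hi

theorem snoc_zero_mem_basedPathSpl {hk : 0 < k} {s : Fin k → R}
    (hs : s ∈ basedCycleSpl G k e hk) :
    (Fin.snoc s 0 : Fin (k + 1) → R) ∈ basedPathSpl G k e := by
  obtain ⟨n, rfl⟩ := Nat.exists_eq_succ_of_ne_zero hk.ne'
  obtain ⟨hs, h0⟩ := mem_basedCycleSpl.1 hs
  refine mem_basedPathSpl.2 ⟨fun i => ?_, ?_, Fin.snoc_last _ _⟩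
  · have hi := hs i
    induction i using Fin.lastCases with
    | last =>
      rw [Fin.succ_last, Fin.snoc_last, Fin.snoc_castSucc]
      simpa [h0] using hi
    | cast i =>
      rw [Fin.succ_castSucc, Fin.snoc_castSucc, Fin.snoc_castSucc]
      simpa [Fin.coeSucc_eq_succ] using hi
  · rw [← Fin.castSucc_zero, Fin.snoc_castSucc, h0]

variable (G k v e)

/-- the kernel of the path-contraction restriction map
`ρ : Spl_R(G,α) → Spl_R(G',α')` is isomorphic as an `R`-module (via restriction to
the path) to `Spl_R(P_k, α|_{P_k}; {v₀,v_k})`, which in turn is isomorphic to the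
based splines `Spl_R(C_k, α|_{P_k}; u)` on the `k`-cycle obtained by identifying
`v₀` with `v_k`. -/
theorem path_contraction_kernel
    (hk : 0 < k)
    (hv : Function.Injective v) (he : Function.Injective e)
    (hpath : ∀ i : Fin k,
      G.ends (e i) = (v i.castSucc, v i.succ) ∨ G.ends (e i) = (v i.succ, v i.castSucc))
    (hdeg : ∀ j : Fin (k + 1), (j : ℕ) ≠ 0 → (j : ℕ) ≠ k → G.degree (v j) = 2) :
    (∃ e₁ : pathKernel G k v ≃ₗ[R] basedPathSpl G k e,
      ∀ p, ∀ j : Fin (k + 1), (e₁ p : Fin (k + 1) → R) j = (p : G.V → R) (v j)) ∧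
    (∃ e₂ : basedPathSpl G k e ≃ₗ[R] basedCycleSpl G k e hk,
      ∀ r, ∀ j : Fin k, (e₂ r : Fin k → R) j = (r : Fin (k + 1) → R) j.castSucc) := by
  constructor
  · refine ⟨LinearEquiv.ofBijective ((LinearMap.funLeft R R v).restrict
      fun p hp => comp_mem_basedPathSpl hv hpath hp) ⟨?_, ?_⟩, fun _ _ => rfl⟩
    · intro p q hpq
      ext w
      by_cases hw : w ∈ pathInterior G k v
      · obtain ⟨j, -, -, rfl⟩ := hw
        exact congrFun (congrArg Subtype.val hpq) j
      · rw [(mem_pathKernel.1 p.2).2 w hw, (mem_pathKernel.1 q.2).2 w hw]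
    · rintro ⟨r, hr⟩
      exact ⟨⟨_, extend_mem_pathKernel hv he hpath hdeg hr⟩,
        Subtype.ext (funext fun j => hv.extend_apply r 0 j)⟩
  · refine ⟨LinearEquiv.ofBijective ((LinearMap.funLeft R R Fin.castSucc).restrict
      fun r hr => comp_castSucc_mem_basedCycleSpl hk hr) ⟨?_, ?_⟩, fun _ _ => rfl⟩
    · intro r t hrt
      ext j
      induction j using Fin.lastCases with
      | last => rw [(mem_basedPathSpl.1 r.2).2.2, (mem_basedPathSpl.1 t.2).2.2]
      | cast j => exact congrFun (congrArg Subtype.val hrt) j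
    · rintro ⟨s, hs⟩
      exact ⟨⟨_, snoc_zero_mem_basedPathSpl hs⟩,
        Subtype.ext (funext fun j => Fin.snoc_castSucc (α := fun _ => R) 0 s j)⟩
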